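/- Let μ > 0, j, k ∈ ℤ, and set β := 2μ + π/2 and S_β := {ζ ∈ ℂ : |Im ζ| < β}. Define D'_μ := {(w₁,w₂,w₃) ∈ ℂ³ : w₂ ≠ 0, w₃ ≠ 0, −π/2 < Im(w₁) − log|w₂w₃|² < π/2, −μ < log|w₂|² < μ, −μ < log|w₃|² < μ}, and define the weight ω_{j,k} : S_β → ℝ by ω_{j,k}(x+iy) := π²·∫∫_{ℝ²} e^{(j+1)s₂}·χ_{(−μ,μ)}(s₂)·e^{(k+1)s₃}·χ_{(−μ,μ)}(s₃)·χ_{(−π/2,π/2)}(y − s₂ − s₃) ds₂ ds₃. Let G : ℂ³ → ℂ be holomorphic and square-integrable on D'_μ, and suppose that for all θ ∈ ℝ and all (w₁,w₂,w₃) ∈ D'_μ one has G(w₁, e^{iθ}w₂, w₃) = e^{ijθ}·G(w₁,w₂,w₃) and G(w₁, w₂, e^{iθ}w₃) = e^{ikθ}·G(w₁,w₂,w₃). Then there exists a holomorphic function g : S_β → ℂ such that G(w₁,w₂,w₃) = g(w₁)·w₂^j·w₃^k for all (w₁,w₂,w₃) ∈ D'_μ, and ∫_{D'_μ} |G|² dV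 = ∫_{S_β} |g(ζ)|²·ω_{j,k}(ζ) dA(ζ). -/

import Mathlib

open Complex MeasureTheory

/-- The unwound model worm `D'_μ`. -/
noncomputable def Dprime (μ : ℝ) : Set (ℂ × ℂ × ℂ) :=
  {w | w.2.1 ≠ 0 ∧ w.2.2 ≠ 0 ∧
    -(Real.pi / 2) < w.1.im - Real.log (‖w.2.1 * w.2.2‖ ^ 2) ∧
    w.1.im - Real.log (‖w.2.1 * w.2.2‖ ^ 2) < Real.pi / 2 ∧
    -μ < Real.log (‖w.2.1‖ ^ 2) ∧ Real.log (‖w.2.1‖ ^ 2) < μ ∧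
    -μ < Real.log (‖w.2.2‖ ^ 2) ∧ Real.log (‖w.2.2‖ ^ 2) < μ}

/-- The strip `S_β = {ζ : |Im ζ| < β}`. -/
def strip (β : ℝ) : Set ℂ := {ζ | |ζ.im| < β}

/-- The weight `ω_{j,k}` on the strip `S_{2μ+π/2}`. -/
noncomputable def wgt (μ : ℝ) (j k : ℤ) (ζ : ℂ) : ℝ :=
  Real.pi ^ 2 * ∫ s₂ : ℝ, ∫ s₃ : ℝ,
    Real.exp (((j : ℝ) + 1) * s₂) * Set.indicator (Set.Ioo (-μ) μ) (fun _ => (1 : ℝ)) s₂ *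
      (Real.exp (((k : ℝ) + 1) * s₃) * Set.indicator (Set.Ioo (-μ) μ) (fun _ => (1 : ℝ)) s₃) *
      Set.indicator (Set.Ioo (-(Real.pi / 2)) (Real.pi / 2)) (fun _ => (1 : ℝ))
        (ζ.im - s₂ - s₃)

/-- Tube domain: logarithmic coordinates of `Dprime`. -/
def tube (μ : ℝ) : Set (ℂ × ℂ × ℂ) :=
  {p | -(Real.pi / 2) < p.1.im - (2 * p.2.1.re + 2 * p.2.2.re) ∧
    p.1.im - (2 * p.2.1.re + 2 * p.2.2.re) < Real.pi / 2 ∧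
    -μ < 2 * p.2.1.re ∧ 2 * p.2.1.re < μ ∧
    -μ < 2 * p.2.2.re ∧ 2 * p.2.2.re < μ}

lemma tube_isOpen (μ : ℝ) : IsOpen (tube μ) := by
  unfold tube
  refine IsOpen.and ?_ (IsOpen.and ?_ (IsOpen.and ?_ (IsOpen.and ?_ (IsOpen.and ?_ ?_)))) <;>
    exact isOpen_lt (by fun_prop) (by fun_prop)

lemma log_prod_sq (a b : ℝ) (ha : a ≠ 0) (hb : b ≠ 0) :
    Real.log ((a * b) ^ 2) = Real.log (a ^ 2) + Real.log (b ^ 2) := by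
  rw [mul_pow, Real.log_mul (by positivity) (by positivity)]

lemma log_exp_sq (x : ℝ) : Real.log (Real.exp x ^ 2) = 2 * x := by
  rw [Real.log_pow, Real.log_exp]; norm_num

lemma exp_mem (μ : ℝ) (p : ℂ × ℂ × ℂ) (hp : p ∈ tube μ) :
    (p.1, Complex.exp p.2.1, Complex.exp p.2.2) ∈ Dprime μ := by
  obtain ⟨h1, h2, h3, h4, h5, h6⟩ := hp
  refine ⟨Complex.exp_ne_zero _, Complex.exp_ne_zero _, ?_⟩
  simp only [norm_mul, Complex.norm_exp]
  rw [log_prod_sq _ _ (Real.exp_ne_zero _) (Real.exp_ne_zero _), log_exp_sq, log_exp_sq]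
  exact ⟨h1, h2, h3, h4, h5, h6⟩

lemma log_mem (μ : ℝ) (w : ℂ × ℂ × ℂ) (hw : w ∈ Dprime μ) :
    (w.1, Complex.log w.2.1, Complex.log w.2.2) ∈ tube μ := by
  obtain ⟨h01, h02, h1, h2, h3, h4, h5, h6⟩ := hw
  rw [norm_mul, log_prod_sq _ _ (norm_ne_zero_iff.2 h01) (norm_ne_zero_iff.2 h02)] at h1 h2
  rw [Real.log_pow] at h1 h2 h3 h4 h5 h6
  rw [Real.log_pow] at h1 h2
  push_cast at h1 h2 h3 h4 h5 h6
  simp only [tube, Set.mem_ofPred_eq, Complex.log_re]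
  exact ⟨h1, h2, h3, h4, h5, h6⟩

/-- A holomorphic function on the tube, invariant under imaginary translations of the last two
variables, depends only on the first one. -/
lemma tube_const (μ : ℝ) (H : ℂ × ℂ × ℂ → ℂ) (hH : DifferentiableOn ℂ H (tube μ))
    (h2 : ∀ θ : ℝ, ∀ p ∈ tube μ, H (p + θ • ((0, Complex.I, 0) : ℂ × ℂ × ℂ)) = H p)
    (h3 : ∀ θ : ℝ, ∀ p ∈ tube μ, H (p + θ • ((0, 0, Complex.I) : ℂ × ℂ × ℂ)) = H p)
    (p q : ℂ × ℂ × ℂ) (hp : p ∈ tube μ) (hq : q ∈ tube μ) (hpq : p.1 = q.1) : H p = H q := by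
  have key : ∀ x ∈ tube μ, ∀ a b : ℂ, fderiv ℂ H x (0, a, b) = 0 := by
    intro x hx a b
    have hd : HasFDerivAt H (fderiv ℂ H x) x :=
      (hH.differentiableAt ((tube_isOpen μ).mem_nhds hx)).hasFDerivAt
    have hdr := hd.restrictScalars ℝ
    have gen : ∀ v : ℂ × ℂ × ℂ, (∀ θ : ℝ, H (x + θ • v) = H x) → fderiv ℂ H x v = 0 := by
      intro v hv
      have e1 : HasDerivAt (fun t : ℝ => H (x + t • v)) (fderiv ℂ H x v) 0 :=
        hdr.hasLineDerivAt v
      have e2 : HasDerivAt (fun t : ℝ => H (x + t • v)) 0 0 := by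
        rw [funext hv]; exact hasDerivAt_const _ _
      exact e1.unique e2
    have k2 := gen (0, Complex.I, 0) (fun θ => h2 θ x hx)
    have k3 := gen (0, 0, Complex.I) (fun θ => h3 θ x hx)
    have : ((0, a, b) : ℂ × ℂ × ℂ) = (-Complex.I * a) • ((0, Complex.I, 0) : ℂ × ℂ × ℂ)
        + (-Complex.I * b) • ((0, 0, Complex.I) : ℂ × ℂ × ℂ) := by
      have hI := Complex.I_mul_I
      ext1
      · simp
      · ext1 <;> simp only [Prod.smul_mk, Prod.mk_add_mk, smul_eq_mul]
        · linear_combination a * hI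
        · linear_combination b * hI
    rw [this, map_add, map_smul, map_smul, k2, k3]; simp
  have hmem : ∀ t ∈ Set.Icc (0 : ℝ) 1, p + t • (q - p) ∈ tube μ := by
    intro t ht
    have hc : Convex ℝ (tube μ) := by
      intro x hx y hy a b ha hb hab
      obtain ⟨x1, x2, x3, x4, x5, x6⟩ := hx
      obtain ⟨y1, y2, y3, y4, y5, y6⟩ := hy
      have cmb : ∀ u v c : ℝ, u < c → v < c → a * u + b * v < c := by
        intro u v c hu hv
        rcases ha.eq_or_lt with h0 | h0
        · subst h0
          have : b = 1 := by linarith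
          subst this; linarith
        · have i1 := mul_lt_mul_of_pos_left hu h0
          have i2 := mul_le_mul_of_nonneg_left hv.le hb
          have : a * c + b * c = c := by rw [← add_mul, hab, one_mul]
          linarith
      have z1 := cmb _ _ _ (neg_lt_neg x1) (neg_lt_neg y1)
      have z2 := cmb _ _ _ x2 y2
      have z3 := cmb _ _ _ (neg_lt_neg x3) (neg_lt_neg y3)
      have z4 := cmb _ _ _ x4 y4
      have z5 := cmb _ _ _ (neg_lt_neg x5) (neg_lt_neg y5)
      have z6 := cmb _ _ _ x6 y6
      simp only [tube, Set.mem_ofPred_eq, Prod.fst_add, Prod.snd_add, Prod.smul_fst, Prod.smul_snd,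
        Complex.add_re, Complex.add_im, Complex.real_smul, Complex.re_ofReal_mul,
        Complex.im_ofReal_mul]
      refine ⟨?_, ?_, ?_, ?_, ?_, ?_⟩ <;> linarith
    exact hc.add_smul_sub_mem hp hq ht
  have hder : ∀ t ∈ Set.Icc (0 : ℝ) 1,
      HasDerivAt (fun t : ℝ => H (p + t • (q - p))) 0 t := by
    intro t ht
    have hd : HasFDerivAt H (fderiv ℂ H (p + t • (q - p))) (p + t • (q - p)) :=
      (hH.differentiableAt ((tube_isOpen μ).mem_nhds (hmem t ht))).hasFDerivAt
    have hdr := hd.restrictScalars ℝ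
    have hl : HasDerivAt (fun t : ℝ => p + t • (q - p)) (q - p) t := by
      simpa using ((hasDerivAt_id t).smul_const (q - p)).const_add p
    have := hdr.comp_hasDerivAt t hl
    have e : fderiv ℂ H (p + t • (q - p)) (q - p) = 0 := by
      have : q - p = (0, q.2.1 - p.2.1, q.2.2 - p.2.2) := by
        ext1
        · simp [hpq]
        · rfl
      have h := key _ (hmem t ht) (q.2.1 - p.2.1) (q.2.2 - p.2.2)
      rwa [← this] at h
    have h2 : HasDerivAt (fun t : ℝ => H (p + t • (q - p)))
      (fderiv ℂ H (p + t • (q - p)) (q - p)) t := this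
    rwa [e] at h2
  have hcst := constant_of_has_deriv_right_zero (a := 0) (b := 1)
    (fun t ht => (hder t ht).continuousAt.continuousWithinAt)
    (fun t ht => (hder t ⟨ht.1, ht.2.le⟩).hasDerivWithinAt) 1 (by simp)
  simpa using hcst.symm

/-- Radial integration in logarithmic coordinates. -/
lemma radial_integral (f : ℝ → ℝ) :
    ∫ w : ℂ, f ‖w‖ = Real.pi * ∫ s : ℝ, Real.exp s * f (Real.exp (s / 2)) := by
  have h1 := integral_fun_norm_addHaar (volume : Measure ℂ) f
  have himg : (fun s : ℝ => Real.exp (s / 2)) '' Set.univ = Set.Ioi 0 := by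
    ext y
    simp only [Set.image_univ, Set.mem_range, Set.mem_Ioi]
    constructor
    · rintro ⟨s, rfl⟩; exact Real.exp_pos _
    · intro hy; exact ⟨2 * Real.log y, by simp [Real.exp_log hy]⟩
  have h2 := integral_image_eq_integral_abs_deriv_smul (s := Set.univ)
    (f := fun s : ℝ => Real.exp (s / 2)) (f' := fun s => Real.exp (s / 2) * (1 / 2))
    MeasurableSet.univ
    (fun x _ => (((hasDerivAt_id x).div_const 2).exp).hasDerivWithinAt)
    (by
      intro x _ y _ h
      have := Real.exp_injective h
      simpa using this)
    (fun y => y * f y)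
  rw [himg] at h2
  rw [h1, Complex.finrank_real_complex]
  simp only [smul_eq_mul, Nat.add_one_sub_one, pow_one, nsmul_eq_mul]
  rw [h2, setIntegral_univ, measureReal_def, Complex.volume_ball]
  have : ∀ s : ℝ, |Real.exp (s / 2) * (1 / 2)| • (Real.exp (s / 2) * f (Real.exp (s / 2)))
      = (1 / 2) * (Real.exp s * f (Real.exp (s / 2))) := by
    intro s
    rw [abs_of_pos (by positivity), smul_eq_mul]
    have : Real.exp s = Real.exp (s / 2) * Real.exp (s / 2) := by rw [← Real.exp_add]; ring_nf
    rw [this]; ring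
  simp only [this, integral_const_mul]
  simp
  ring

open Classical in
/-- The radial profile of `‖w₂^j w₃^k‖²` on the slice of `Dprime`. -/
noncomputable def prof (μ : ℝ) (j k : ℤ) (y a b : ℝ) : ℝ :=
  if a ≠ 0 ∧ b ≠ 0 ∧
    -(Real.pi / 2) < y - Real.log ((a * b) ^ 2) ∧
    y - Real.log ((a * b) ^ 2) < Real.pi / 2 ∧
    -μ < Real.log (a ^ 2) ∧ Real.log (a ^ 2) < μ ∧
    -μ < Real.log (b ^ 2) ∧ Real.log (b ^ 2) < μ then (a ^ j) ^ 2 * (b ^ k) ^ 2 else 0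

lemma exp_half_zpow (s : ℝ) (j : ℤ) :
    Real.exp s * (Real.exp (s / 2) ^ j) ^ 2 = Real.exp (((j : ℝ) + 1) * s) := by
  have : Real.exp (s / 2) ^ j = Real.exp (s / 2 * j) := by
    rw [Real.exp_mul, Real.rpow_intCast]
  rw [this, ← Real.exp_nat_mul, ← Real.exp_add]
  congr 1; push_cast; ring

lemma prof_exp (μ : ℝ) (j k : ℤ) (y s t : ℝ) :
    Real.exp s * (Real.exp t * prof μ j k y (Real.exp (s / 2)) (Real.exp (t / 2))) =
    Real.exp (((j : ℝ) + 1) * s) * Set.indicator (Set.Ioo (-μ) μ) (fun _ => (1 : ℝ)) s *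
      (Real.exp (((k : ℝ) + 1) * t) * Set.indicator (Set.Ioo (-μ) μ) (fun _ => (1 : ℝ)) t) *
      Set.indicator (Set.Ioo (-(Real.pi / 2)) (Real.pi / 2)) (fun _ => (1 : ℝ))
        (y - s - t) := by
  unfold prof
  rw [log_prod_sq _ _ (Real.exp_ne_zero _) (Real.exp_ne_zero _), log_exp_sq, log_exp_sq]
  have e1 : 2 * (s / 2) = s := by ring
  have e2 : 2 * (t / 2) = t := by ring
  have e3 : y - (s + t) = y - s - t := by ring
  rw [e1, e2, e3, ← exp_half_zpow, ← exp_half_zpow]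
  by_cases h1 : s ∈ Set.Ioo (-μ) μ
  · by_cases h2 : t ∈ Set.Ioo (-μ) μ
    · by_cases h3 : y - s - t ∈ Set.Ioo (-(Real.pi / 2)) (Real.pi / 2)
      · rw [if_pos ⟨Real.exp_ne_zero _, Real.exp_ne_zero _, h3.1, h3.2, h1.1, h1.2, h2.1, h2.2⟩,
          Set.indicator_of_mem h1, Set.indicator_of_mem h2, Set.indicator_of_mem h3]
        ring
      · rw [if_neg (fun h => h3 ⟨h.2.2.1, h.2.2.2.1⟩), Set.indicator_of_notMem h3]; simp
    · rw [if_neg (fun h => h2 ⟨h.2.2.2.2.2.2.1, h.2.2.2.2.2.2.2⟩), Set.indicator_of_notMem h2]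
      simp
  · rw [if_neg (fun h => h1 ⟨h.2.2.2.2.1, h.2.2.2.2.2.1⟩), Set.indicator_of_notMem h1]; simp

lemma prof_integral (μ : ℝ) (j k : ℤ) (ζ : ℂ) :
    ∫ u : ℂ, ∫ v : ℂ, prof μ j k ζ.im ‖u‖ ‖v‖ = wgt μ j k ζ := by
  have h1 : ∀ u : ℂ, ∫ v : ℂ, prof μ j k ζ.im ‖u‖ ‖v‖ =
      Real.pi * ∫ t : ℝ, Real.exp t * prof μ j k ζ.im ‖u‖ (Real.exp (t / 2)) :=
    fun u => radial_integral _
  simp only [h1]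
  rw [radial_integral (fun a => Real.pi * ∫ t : ℝ, Real.exp t * prof μ j k ζ.im a (Real.exp (t / 2)))]
  unfold wgt
  simp only [← prof_exp, integral_const_mul]
  simp only [mul_left_comm _ Real.pi, integral_const_mul]
  ring

lemma wgt_zero (μ : ℝ) (j k : ℤ) (ζ : ℂ) (hζ : ζ ∉ strip (2 * μ + Real.pi / 2)) :
    wgt μ j k ζ = 0 := by
  unfold wgt
  have : ∀ s t : ℝ, Real.exp (((j : ℝ) + 1) * s) *
      Set.indicator (Set.Ioo (-μ) μ) (fun _ => (1 : ℝ)) s *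
      (Real.exp (((k : ℝ) + 1) * t) * Set.indicator (Set.Ioo (-μ) μ) (fun _ => (1 : ℝ)) t) *
      Set.indicator (Set.Ioo (-(Real.pi / 2)) (Real.pi / 2)) (fun _ => (1 : ℝ))
        (ζ.im - s - t) = 0 := by
    intro s t
    by_cases h1 : s ∈ Set.Ioo (-μ) μ
    · by_cases h2 : t ∈ Set.Ioo (-μ) μ
      · have h3 : ζ.im - s - t ∉ Set.Ioo (-(Real.pi / 2)) (Real.pi / 2) := by
          intro h3
          apply hζ
          simp only [strip, Set.mem_ofPred_eq, abs_lt]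
          obtain ⟨a1, a2⟩ := h1
          obtain ⟨b1, b2⟩ := h2
          obtain ⟨c1, c2⟩ := h3
          constructor <;> linarith
        rw [Set.indicator_of_notMem h3]; simp
      · rw [Set.indicator_of_notMem h2]; simp
    · rw [Set.indicator_of_notMem h1]; simp
  simp [this]

lemma Dprime_measurable (μ : ℝ) : MeasurableSet (Dprime μ) := by
  unfold Dprime
  have l : ∀ f : ℂ × ℂ × ℂ → ℝ, Measurable f → ∀ g : ℂ × ℂ × ℂ → ℝ, Measurable g →
    MeasurableSet {w | f w < g w} := fun f hf g hg => measurableSet_lt hf hg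
  refine MeasurableSet.inter ?_ (MeasurableSet.inter ?_ (MeasurableSet.inter ?_
    (MeasurableSet.inter ?_ (MeasurableSet.inter ?_ (MeasurableSet.inter ?_
    (MeasurableSet.inter ?_ ?_))))))
  · exact (measurableSet_eq_fun (by fun_prop) (by fun_prop)).compl
  · exact (measurableSet_eq_fun (by fun_prop) (by fun_prop)).compl
  all_goals exact l _ (by fun_prop) _ (by fun_prop)

/-- A holomorphic square-integrable function on `D'_μ` that is `(j,k)`-equivariant under
rotations in the last two variables is of the form `g(w₁)·w₂^j·w₃^k` with `g` holomorphic
on the strip `S_{2μ+π/2}`, and its `L²` norm equals the weighted `L²` norm of `g`. -/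
theorem equivariant_representation (μ : ℝ) (hμ : 0 < μ) (j k : ℤ)
    (G : ℂ × ℂ × ℂ → ℂ) (hG : DifferentiableOn ℂ G (Dprime μ))
    (hGL2 : IntegrableOn (fun w => ‖G w‖ ^ 2) (Dprime μ) volume)
    (hrot2 : ∀ θ : ℝ, ∀ w ∈ Dprime μ,
      G (w.1, Complex.exp (Complex.I * (θ : ℂ)) * w.2.1, w.2.2) =
        Complex.exp (Complex.I * (j : ℂ) * (θ : ℂ)) * G w)
    (hrot3 : ∀ θ : ℝ, ∀ w ∈ Dprime μ,
      G (w.1, w.2.1, Complex.exp (Complex.I * (θ : ℂ)) * w.2.2) =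
        Complex.exp (Complex.I * (k : ℂ) * (θ : ℂ)) * G w) :
    ∃ g : ℂ → ℂ, DifferentiableOn ℂ g (strip (2 * μ + Real.pi / 2)) ∧
      (∀ w ∈ Dprime μ, G w = g w.1 * w.2.1 ^ j * w.2.2 ^ k) ∧
      ∫ w in Dprime μ, ‖G w‖ ^ 2 =
        ∫ ζ in strip (2 * μ + Real.pi / 2), ‖g ζ‖ ^ 2 * wgt μ j k ζ := by
  have hpi := Real.pi_pos
  set H : ℂ × ℂ × ℂ → ℂ := fun p =>
    G (p.1, Complex.exp p.2.1, Complex.exp p.2.2) * Complex.exp (-(j * p.2.1)) *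
      Complex.exp (-(k * p.2.2)) with hHdef
  have hH : DifferentiableOn ℂ H (tube μ) := by
    have h0 : DifferentiableOn ℂ
        (fun p : ℂ × ℂ × ℂ => G (p.1, Complex.exp p.2.1, Complex.exp p.2.2)) (tube μ) :=
      hG.comp (g := G) (f := fun p : ℂ × ℂ × ℂ => (p.1, Complex.exp p.2.1, Complex.exp p.2.2))
        (by fun_prop) (fun p hp => exp_mem μ p hp)
    exact (h0.mul (by fun_prop)).mul (by fun_prop)
  have hinv2 : ∀ θ : ℝ, ∀ p ∈ tube μ, H (p + θ • ((0, Complex.I, 0) : ℂ × ℂ × ℂ)) = H p := by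
    intro θ p hp
    have := hrot2 θ _ (exp_mem μ p hp)
    simp only [hHdef, Prod.fst_add, Prod.snd_add, Prod.smul_fst, Prod.smul_snd, smul_zero,
      add_zero, Complex.real_smul]
    rw [Complex.exp_add, mul_comm (Complex.exp p.2.1), mul_comm (θ : ℂ) Complex.I, this,
      mul_add, neg_add, Complex.exp_add (-(j * p.2.1)),
      show -((j : ℂ) * (Complex.I * θ)) = -(Complex.I * j * θ) by ring, Complex.exp_neg (Complex.I * j * θ)]
    field_simp [Complex.exp_ne_zero]
  have hinv3 : ∀ θ : ℝ, ∀ p ∈ tube μ, H (p + θ • ((0, 0, Complex.I) : ℂ × ℂ × ℂ)) = H p := by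
    intro θ p hp
    have := hrot3 θ _ (exp_mem μ p hp)
    simp only [hHdef, Prod.fst_add, Prod.snd_add, Prod.smul_fst, Prod.smul_snd, smul_zero,
      add_zero, Complex.real_smul]
    rw [Complex.exp_add, mul_comm (Complex.exp p.2.2), mul_comm (θ : ℂ) Complex.I, this,
      mul_add, neg_add, Complex.exp_add (-(k * p.2.2)),
      show -((k : ℂ) * (Complex.I * θ)) = -(Complex.I * k * θ) by ring, Complex.exp_neg (Complex.I * k * θ)]
    field_simp [Complex.exp_ne_zero]
  set β : ℝ := 2 * μ + Real.pi / 2 with hβ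
  have hβpos : 0 < β := by positivity
  set c : ℝ := μ / (2 * β) with hc
  set σ : ℂ → ℂ × ℂ × ℂ := fun ζ => (ζ, -Complex.I * c * ζ, -Complex.I * c * ζ) with hσ
  have hσre : ∀ ζ : ℂ, (-Complex.I * c * ζ).re = c * ζ.im := by intro ζ; simp
  have hσmem : ∀ ζ ∈ strip β, σ ζ ∈ tube μ := by
    intro ζ hζ
    simp only [strip, Set.mem_ofPred_eq, abs_lt] at hζ
    simp only [hσ, tube, Set.mem_ofPred_eq, hσre]
    have hcpos : 0 < c := by positivity
    have hcβ : 2 * c * β = μ := by rw [hc]; field_simp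
    have m1 := mul_lt_mul_of_pos_left hζ.1 hcpos
    have m2 := mul_lt_mul_of_pos_left hζ.2 hcpos
    have h4 : 0 < 1 - 4 * c := by
      have : (1 - 4 * c) * β = Real.pi / 2 := by rw [hβ] at hcβ ⊢; linarith
      by_contra hn
      have := mul_nonneg (sub_nonneg.2 (not_lt.1 hn)) hβpos.le
      linarith
    have m3 := mul_lt_mul_of_pos_left hζ.1 h4
    have m4 := mul_lt_mul_of_pos_left hζ.2 h4
    have hq : (1 - 4 * c) * β = Real.pi / 2 := by rw [hβ] at hcβ ⊢; linarith
    refine ⟨?_, ?_, ?_, ?_, ?_, ?_⟩ <;> nlinarith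
  have hstrip : ∀ w ∈ Dprime μ, w.1 ∈ strip β := by
    intro w hw
    obtain ⟨h1, h2, h3, h4, h5, h6⟩ := log_mem μ w hw
    simp only [strip, Set.mem_ofPred_eq, abs_lt]
    simp only at h1 h2 h3 h4 h5 h6
    constructor <;> linarith
  have hrep : ∀ w ∈ Dprime μ, G w = H (σ w.1) * w.2.1 ^ j * w.2.2 ^ k := by
    intro w hw
    have e := tube_const μ H hH hinv2 hinv3 _ _ (log_mem μ w hw) (hσmem _ (hstrip w hw)) rfl
    rw [← e]
    simp only [hHdef, Complex.exp_log hw.1, Complex.exp_log hw.2.1, Complex.exp_neg,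
      Complex.exp_int_mul]
    have n1 : w.2.1 ^ j ≠ 0 := zpow_ne_zero _ hw.1
    have n2 : w.2.2 ^ k ≠ 0 := zpow_ne_zero _ hw.2.1
    field_simp
  refine ⟨fun ζ => H (σ ζ), hH.comp (by fun_prop) hσmem, hrep, ?_⟩
  have hind : ∀ w : ℂ × ℂ × ℂ, (Dprime μ).indicator (fun w => ‖G w‖ ^ 2) w =
      ‖H (σ w.1)‖ ^ 2 * prof μ j k w.1.im ‖w.2.1‖ ‖w.2.2‖ := by
    intro w
    unfold prof
    by_cases hw : w ∈ Dprime μ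
    · rw [Set.indicator_of_mem hw, if_pos, hrep w hw, norm_mul, norm_mul, norm_zpow, norm_zpow]
      · ring
      · simpa only [Dprime, Set.mem_ofPred_eq, norm_mul, ne_eq, norm_eq_zero] using hw
    · rw [Set.indicator_of_notMem hw, if_neg, mul_zero]
      simpa only [Dprime, Set.mem_ofPred_eq, norm_mul, ne_eq, norm_eq_zero] using hw
  have hint := (integrable_indicator_iff (Dprime_measurable μ)).2 hGL2
  rw [← integral_indicator (Dprime_measurable μ)]
  rw [funext hind] at hint ⊢
  rw [Measure.volume_eq_prod] at hint ⊢
  rw [integral_prod _ hint]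
  rw [setIntegral_eq_integral_of_forall_compl_eq_zero
    (fun ζ hζ => by rw [wgt_zero μ j k ζ hζ, mul_zero])]
  refine integral_congr_ae ?_
  filter_upwards [hint.prod_right_ae] with ζ hζ
  rw [Measure.volume_eq_prod] at hζ ⊢
  rw [integral_prod _ hζ]
  simp only [integral_const_mul]
  rw [prof_integral]
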